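/- Let m ≥ 3 and let I_m = ⟨ x_{i,1}^3 x_{i,2} (1 ≤ i ≤ m), x_{i,1}^2 x_{i+1,1} x_{i+1,2} (1 ≤ i ≤ m, with the first index taken cyclically modulo m) ⟩ ⊆ k[x_{1,1},x_{1,2},…,x_{m,1},x_{m,2}]. Define integers K^m_{a,b} for a, b ≥ 0 by the base cases K^m_{a,0} = m+a, K^m_{0,b} = C(m, b+1), K^m_{1,b} = C(m,b) + C(m,b+1), and the recurrence K^m_{a,b} = K^m_{a−2,b−1} + K^m_{a−1,b} for a ≥ 2, b ≥ 1. Then β_0(I_m) = 2m and β_i(I_m) = 2·K^m_{m−3,i−1} + K^m_{m−2,i} for every i ≥ 1. -/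

import Mathlib

open MvPolynomial CategoryTheory

/-- The `i`-th total Betti number of `I ⊆ R = 𝕜[x_j : j ∈ σ]`:
`β_i(I) = dim_𝕜 Tor_i^R(I, 𝕜)`, where `𝕜` carries the `R`-module structure of the
residue field `R ⧸ (x_j : j ∈ σ)`. -/
noncomputable def betti (𝕜 : Type) [Field 𝕜] {σ : Type} (I : Ideal (MvPolynomial σ 𝕜)) (i : ℕ) :
    Cardinal :=
  Module.rank 𝕜 (RestrictScalars 𝕜 (MvPolynomial σ 𝕜)
    (((Tor (ModuleCat (MvPolynomial σ 𝕜)) i).obj (ModuleCat.of _ I)).obj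
      (ModuleCat.of _ (MvPolynomial σ 𝕜 ⧸ Ideal.span (Set.range (X : σ → MvPolynomial σ 𝕜))))))
/-- The numbers `K^m_{a,b}`, defined by the base cases `K^m_{a,0} = m+a`,
`K^m_{0,b} = C(m,b+1)`, `K^m_{1,b} = C(m,b) + C(m,b+1)`, and the recurrence
`K^m_{a,b} = K^m_{a−2,b−1} + K^m_{a−1,b}` for `a ≥ 2`, `b ≥ 1`. -/
def Kno (m : ℕ) : ℕ → ℕ → ℕ
  | a, 0 => m + a
  | 0, b + 1 => Nat.choose m (b + 2)
  | 1, b + 1 => Nat.choose m (b + 1) + Nat.choose m (b + 2)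
  | a + 2, b + 1 => Kno m a b + Kno m (a + 1) (b + 1)

namespace BettiAux
open MonoidalCategory

section hom
variable {A : Type} [CommRing A] {K : ModuleCat.{0} A} (P : ProjectiveResolution K)

/-- The complex `M ⊗ P`. -/
noncomputable def tc (M : ModuleCat.{0} A) : ChainComplex (ModuleCat.{0} A) ℕ :=
  (((tensoringLeft (ModuleCat.{0} A)).obj M).mapHomologicalComplex _).obj P.complex

/-- The map of complexes induced by a module map. -/
noncomputable def tcMap {M N : ModuleCat.{0} A} (f : M ⟶ N) : tc P M ⟶ tc P N :=
  (NatTrans.mapHomologicalComplex ((tensoringLeft (ModuleCat.{0} A)).map f) _).app P.complex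

lemma tcMap_f {M N : ModuleCat.{0} A} (f : M ⟶ N) (n : ℕ) :
    (tcMap P f).f n = f ▷ P.complex.X n := rfl

lemma tcMap_comp {M N L : ModuleCat.{0} A} (f : M ⟶ N) (g : N ⟶ L) :
    tcMap P (f ≫ g) = tcMap P f ≫ tcMap P g := by
  ext n : 1
  exact comp_whiskerRight f g (P.complex.X n)

lemma tcMap_id (M : ModuleCat.{0} A) : tcMap P (𝟙 M) = 𝟙 (tc P M) := by
  ext n : 1
  exact id_whiskerRight M (P.complex.X n)

lemma tcMap_zero (M N : ModuleCat.{0} A) :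
    tcMap P (0 : M ⟶ N) = 0 := by
  ext n : 1
  exact MonoidalPreadditive.zero_whiskerRight

/-- functoriality for isomorphisms -/
noncomputable def tcIso {M N : ModuleCat.{0} A} (e : M ≅ N) : tc P M ≅ tc P N where
  hom := tcMap P e.hom
  inv := tcMap P e.inv
  hom_inv_id := by rw [← tcMap_comp, e.hom_inv_id, tcMap_id]
  inv_hom_id := by rw [← tcMap_comp, e.inv_hom_id, tcMap_id]

/-- Tor computed by `P`. -/
noncomputable def torIso (M : ModuleCat.{0} A) (i : ℕ) :
    ((Tor (ModuleCat.{0} A) i).obj M).obj K ≅ (tc P M).homology i :=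
  P.isoLeftDerivedObj ((tensoringLeft (ModuleCat.{0} A)).obj M) i

/-- short complex of complexes -/
noncomputable def tcSC (S : ShortComplex (ModuleCat.{0} A)) :
    ShortComplex (ChainComplex (ModuleCat.{0} A) ℕ) :=
  ShortComplex.mk (tcMap P S.f) (tcMap P S.g) (by rw [← tcMap_comp, S.zero, tcMap_zero])

lemma tcSC_shortExact (S : ShortComplex (ModuleCat.{0} A)) (hS : S.ShortExact) :
    (tcSC P S).ShortExact := by
  apply HomologicalComplex.shortExact_of_degreewise_shortExact
  intro n
  have : Module.Projective A (P.complex.X n) :=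
    (IsProjective.iff_projective _).2 (P.projective n)
  have hex := (ShortComplex.ShortExact.moduleCat_exact_iff_function_exact S).1 hS.exact
  have hi := hS.moduleCat_injective_f
  have hs := hS.moduleCat_surjective_g
  refine ShortComplex.ShortExact.mk' ?_ ?_ ?_
  · rw [ShortComplex.ShortExact.moduleCat_exact_iff_function_exact]
    exact Module.Flat.rTensor_exact (P.complex.X n) hex
  · rw [ModuleCat.mono_iff_injective]
    exact Module.Flat.rTensor_preserves_injective_linearMap (M := P.complex.X n) S.f.hom hi
  · rw [ModuleCat.epi_iff_surjective]
    exact LinearMap.rTensor_surjective (P.complex.X n) (g := S.g.hom) hs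

/-- multiplication by `x` on `P` -/
noncomputable def smulP (x : A) : P.complex ⟶ P.complex where
  f n := ModuleCat.ofHom (x • LinearMap.id)
  comm' i j _ := by
    ext p
    simp

/-- multiplication by `x` on `M ⊗ P` -/
noncomputable def tcSmul (x : A) (M : ModuleCat.{0} A) : tc P M ⟶ tc P M :=
  (((tensoringLeft (ModuleCat.{0} A)).obj M).mapHomologicalComplex _).map (smulP P x)

lemma smulP_tensor (x : A) (M : ModuleCat.{0} A) (hx : ∀ k : K, x • k = 0) (i : ℕ) :
    HomologicalComplex.homologyMap (tcSmul P x M) i = 0 := by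
  have h : Homotopy (smulP P x) 0 := by
    apply ProjectiveResolution.liftHomotopy (0 : K ⟶ K) (P := P) (Q := P)
    · apply HomologicalComplex.to_single_hom_ext
      apply ModuleCat.hom_ext
      apply LinearMap.ext
      intro p
      have h0 : (P.π.f 0).hom (x • p) = x • (P.π.f 0).hom p := map_smul _ _ _
      simp only [Functor.map_zero, Limits.comp_zero]
      exact h0.trans (hx ((P.π.f 0).hom p))
    · simp
  have h2 := Functor.mapHomotopy ((tensoringLeft (ModuleCat.{0} A)).obj M) h
  have h3 := h2.homologyMap_eq i
  refine h3.trans ?_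
  rw [Functor.map_zero, HomologicalComplex.homologyMap_zero]
  rfl

/-- Multiplication by an element killing `K` is zero on Tor. -/
lemma tcMap_smul_homology {M N : ModuleCat.{0} A} (f g : M ⟶ N) (x : A)
    (hx : ∀ k : K, x • k = 0) (hf : ∀ a, f.hom a = x • g.hom a) (i : ℕ) :
    HomologicalComplex.homologyMap (tcMap P f) i = 0 := by
  have : tcMap P f = tcSmul P x M ≫ tcMap P g := by
    ext n : 1
    apply ModuleCat.hom_ext
    apply TensorProduct.ext'
    intro a p
    change (f.hom a) ⊗ₜ[A] p = (g.hom a) ⊗ₜ[A] (x • p)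
    rw [hf, TensorProduct.tmul_smul, TensorProduct.smul_tmul']
  rw [this, HomologicalComplex.homologyMap_comp, smulP_tensor P x M hx i, Limits.zero_comp]

/-- `A ⊗ P ≅ P` -/
noncomputable def tcUnit : tc P (𝟙_ (ModuleCat.{0} A)) ≅ P.complex :=
  HomologicalComplex.Hom.isoOfComponents (fun n => λ_ (P.complex.X n))
    (fun i j _ => (leftUnitor_naturality (P.complex.d i j)).symm)

/-- `H_0(A ⊗ P) ≅ K` -/
noncomputable def tcUnit0 : (tc P (𝟙_ (ModuleCat.{0} A))).homology 0 ≅ K :=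
  HomologicalComplex.homologyMapIso (tcUnit P) 0 ≪≫ isoOfQuasiIsoAt P.π 0 ≪≫
     HomologicalComplex.singleObjHomologySelfIso _ _ _

lemma tcUnit_succ (i : ℕ) : Limits.IsZero ((tc P (𝟙_ (ModuleCat.{0} A))).homology (i+1)) :=
  (P.complex_exactAt_succ i).isZero_homology.of_iso (HomologicalComplex.homologyMapIso (tcUnit P) _)

end hom
end BettiAux
namespace BettiAux
open MonoidalCategory

section rank
variable (𝕜 : Type) [Field 𝕜] {A : Type} [CommRing A] [Algebra 𝕜 A]

/-- vector space structure on a module over an algebra -/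
@[reducible] def vs (M : ModuleCat.{0} A) : Module 𝕜 M := Module.compHom M (algebraMap 𝕜 A)

/-- rank over the ground field -/
noncomputable def rk (M : ModuleCat.{0} A) : Cardinal :=
  let _ := vs 𝕜 M
  Module.rank 𝕜 M

lemma rk_eq (M : ModuleCat.{0} A) : Module.rank 𝕜 (RestrictScalars 𝕜 A M) = rk 𝕜 M := rfl

/-- restriction of scalars of a morphism -/
def rsMap {M N : ModuleCat.{0} A} (f : M ⟶ N) :
    letI := vs 𝕜 M
    letI := vs 𝕜 N
    M →ₗ[𝕜] N :=
  let _ := vs 𝕜 M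
  let _ := vs 𝕜 N
  { toFun := fun a => f.hom a
    map_add' := fun a b => map_add f.hom a b
    map_smul' := fun c a => map_smul f.hom (algebraMap 𝕜 A c) a }

lemma rk_exact (S : ShortComplex (ModuleCat.{0} A)) (hS : S.ShortExact) :
    rk 𝕜 S.X₂ = rk 𝕜 S.X₁ + rk 𝕜 S.X₃ := by
  have hex := (ShortComplex.ShortExact.moduleCat_exact_iff_function_exact S).1 hS.exact
  have hi := hS.moduleCat_injective_f
  have hs := hS.moduleCat_surjective_g
  let _ := vs 𝕜 S.X₁
  let _ := vs 𝕜 S.X₂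
  let _ := vs 𝕜 S.X₃
  have h1 := LinearMap.rank_range_add_rank_ker (rsMap 𝕜 S.g)
  have h2 : LinearMap.ker (rsMap 𝕜 S.g) = LinearMap.range (rsMap 𝕜 S.f) := by
    ext b
    exact hex b
  have h3 : Module.rank 𝕜 (LinearMap.range (rsMap 𝕜 S.f)) = rk 𝕜 S.X₁ :=
    rank_range_of_injective (rsMap 𝕜 S.f) hi
  have h4 : Module.rank 𝕜 (LinearMap.range (rsMap 𝕜 S.g)) = rk 𝕜 S.X₃ :=
    rank_range_of_surjective (rsMap 𝕜 S.g) hs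
  rw [h2, h3, h4] at h1
  rw [add_comm]
  exact h1.symm

/-- A surjection between one-dimensional modules is injective. -/
lemma mono_of_rk_one {M N : ModuleCat.{0} A} (f : M ⟶ N) [Epi f] (h1 : rk 𝕜 M = 1)
    (h2 : rk 𝕜 N = 1) : Mono f := by
  let _ := vs 𝕜 M
  let _ := vs 𝕜 N
  have hs : Function.Surjective (rsMap 𝕜 f) := (ModuleCat.epi_iff_surjective f).1 inferInstance
  have h1' : Module.rank 𝕜 M = 1 := h1
  have h2' : Module.rank 𝕜 N = 1 := h2
  have : FiniteDimensional 𝕜 M := Module.finite_of_rank_eq_one h1'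
  have : FiniteDimensional 𝕜 N := Module.finite_of_rank_eq_one h2'
  have e : Module.finrank 𝕜 M = Module.finrank 𝕜 N := by
    simp [Module.finrank, h1', h2']
  exact (ModuleCat.mono_iff_injective f).2
    ((LinearMap.injective_iff_surjective_of_finrank_eq_finrank e).2 hs)

lemma rk_iso {M N : ModuleCat.{0} A} (e : M ≅ N) : rk 𝕜 M = rk 𝕜 N := by
  let _ := vs 𝕜 M
  let _ := vs 𝕜 N
  refine LinearEquiv.rank_eq (LinearEquiv.ofLinearMap (rsMap 𝕜 e.hom) (rsMap 𝕜 e.inv) ?_ ?_)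
  · ext a
    exact congrArg (fun f => f.hom a) e.inv_hom_id
  · ext a
    exact congrArg (fun f => f.hom a) e.hom_inv_id

lemma rk_isZero {M : ModuleCat.{0} A} (h : Limits.IsZero M) : rk 𝕜 M = 0 := by
  let _ := vs 𝕜 M
  have : Subsingleton M := ModuleCat.subsingleton_of_isZero h
  exact rank_subsingleton' 𝕜 _

variable {K : ModuleCat.{0} A} (P : ProjectiveResolution K)

open HomologicalComplex in
/-- splitting of the long exact sequence -/
lemma rk_split_succ (S : ShortComplex (ModuleCat.{0} A)) (hS : S.ShortExact)
    (h : ∀ i, homologyMap (tcMap P S.f) i = 0) (i : ℕ) :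
    rk 𝕜 ((tc P S.X₃).homology (i+1)) =
      rk 𝕜 ((tc P S.X₂).homology (i+1)) + rk 𝕜 ((tc P S.X₁).homology i) := by
  have hT := tcSC_shortExact P S hS
  have hr : (ComplexShape.down ℕ).Rel (i+1) i := by simp
  have e1 := hT.homology_exact₁ (i+1) i hr
  have e2 := hT.homology_exact₂ (i+1)
  have e3 := hT.homology_exact₃ (i+1) i hr
  refine rk_exact 𝕜 _ (ShortComplex.ShortExact.mk' e3 ?_ ?_)
  · exact (ShortComplex.exact_iff_mono _ (h (i+1))).1 e2
  · exact (ShortComplex.exact_iff_epi _ (h i)).1 e1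

open HomologicalComplex in
lemma epi_zero (S : ShortComplex (ModuleCat.{0} A)) (hS : S.ShortExact) :
    Epi (homologyMap (tcMap P S.g) 0) := by
  have : Epi (tcMap P S.g) := (tcSC_shortExact P S hS).epi_g
  exact epi_homologyMap_of_epi_of_not_rel (tcMap P S.g) 0 (by simp)

open HomologicalComplex in
lemma rk_split_zero (S : ShortComplex (ModuleCat.{0} A)) (hS : S.ShortExact)
    (h : homologyMap (tcMap P S.f) 0 = 0) :
    rk 𝕜 ((tc P S.X₃).homology 0) = rk 𝕜 ((tc P S.X₂).homology 0) := by
  have hT := tcSC_shortExact P S hS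
  have e2 := hT.homology_exact₂ 0
  have hm : Mono (homologyMap (tcMap P S.g) 0) := (ShortComplex.exact_iff_mono _ h).1 e2
  have he : Epi (homologyMap (tcMap P S.g) 0) := epi_zero P S hS
  have := isIso_of_mono_of_epi (homologyMap (tcMap P S.g) 0)
  exact (rk_iso 𝕜 (asIso (homologyMap (tcMap P S.g) 0))).symm

open HomologicalComplex in
/-- From `R/I` to `I`. -/
lemma rk_shift (S : ShortComplex (ModuleCat.{0} A)) (hS : S.ShortExact)
    (e : S.X₂ ≅ 𝟙_ (ModuleCat.{0} A)) (hK : rk 𝕜 K = 1)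
    (h3 : rk 𝕜 ((tc P S.X₃).homology 0) = 1) (i : ℕ) :
    rk 𝕜 ((tc P S.X₁).homology i) = rk 𝕜 ((tc P S.X₃).homology (i+1)) := by
  have hT := tcSC_shortExact P S hS
  have e' : ∀ i, (tc P S.X₂).homology i ≅ (tc P (𝟙_ (ModuleCat.{0} A))).homology i := fun i =>
    homologyMapIso ⟨tcMap P e.hom, tcMap P e.inv, by
      rw [← tcMap_comp, e.hom_inv_id, tcMap_id], by
      rw [← tcMap_comp, e.inv_hom_id, tcMap_id]⟩ i
  have hz : ∀ i, Limits.IsZero ((tc P S.X₂).homology (i+1)) := fun i =>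
    (tcUnit_succ P i).of_iso (e' _)
  have hr : (ComplexShape.down ℕ).Rel (i+1) i := by simp
  have hm : Mono (hT.δ (i+1) i hr) := hT.mono_δ _ _ _ (hz i)
  have he : Epi (hT.δ (i+1) i hr) := by
    cases i with
    | succ i => exact hT.epi_δ _ _ _ (hz i)
    | zero =>
      have h2 : rk 𝕜 ((tc P S.X₂).homology 0) = 1 := by
        rw [rk_iso 𝕜 (e' 0), rk_iso 𝕜 (tcUnit0 P), hK]
      have := epi_zero P S hS
      have hm := mono_of_rk_one 𝕜 (homologyMap (tcMap P S.g) 0) h2 h3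
      have h0 : homologyMap (tcMap P S.f) 0 = 0 := by
        rw [← cancel_mono (homologyMap (tcMap P S.g) 0), ← homologyMap_comp, ← tcMap_comp, S.zero,
          tcMap_zero]
        simp
      exact (ShortComplex.exact_iff_epi _ h0).1 (hT.homology_exact₁ 1 0 hr)
  have := isIso_of_mono_of_epi (hT.δ (i+1) i hr)
  exact (rk_iso 𝕜 (asIso (hT.δ (i+1) i hr))).symm

end rank
end BettiAux
namespace BettiAux
open MonoidalCategory

section mono
variable (𝕜 : Type) [Field 𝕜] {σ : Type}

variable (σ) in
/-- residue field -/
noncomputable def Km : ModuleCat.{0} (MvPolynomial σ 𝕜) :=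
  ModuleCat.of _ (MvPolynomial σ 𝕜 ⧸ Ideal.span (Set.range (X : σ → MvPolynomial σ 𝕜)))

variable (σ) in
/-- its resolution -/
noncomputable def PK : ProjectiveResolution (Km 𝕜 σ) := projectiveResolution (Km 𝕜 σ)

lemma X_smul_Km (x : σ) (k : Km 𝕜 σ) : (X x : MvPolynomial σ 𝕜) • k = 0 := by
  obtain ⟨p, rfl⟩ := Submodule.Quotient.mk_surjective _ k
  change Submodule.Quotient.mk ((X x : MvPolynomial σ 𝕜) • p) = _
  refine (Submodule.Quotient.mk_eq_zero _).2 ?_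
  rw [smul_eq_mul]
  exact Ideal.mul_mem_right _ _ (Ideal.subset_span ⟨x, rfl⟩)

lemma rk_Km : rk 𝕜 (Km 𝕜 σ) = 1 := by
  let _ := vs 𝕜 (Km 𝕜 σ)
  let f : 𝕜 →ₗ[𝕜] Km 𝕜 σ :=
    { toFun := fun c => Submodule.Quotient.mk (C c)
      map_add' := fun a b => by simp; rfl
      map_smul' := fun a b => by
        simp
        rfl }
  have hC : ∀ p : MvPolynomial σ 𝕜, p - C (constantCoeff p) ∈
      Ideal.span (Set.range (X : σ → MvPolynomial σ 𝕜)) := by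
    intro p
    induction p using MvPolynomial.induction_on with
    | C a => simp
    | add p q hp hq =>
      have := add_mem hp hq
      convert this using 1
      simp
      ring
    | mul_X p x hp =>
      simp
      exact Ideal.mul_mem_left _ _ (Ideal.subset_span ⟨x, rfl⟩)
  have hi : Function.Injective f := by
    rw [injective_iff_map_eq_zero]
    intro a ha
    have h1 : (C a : MvPolynomial σ 𝕜) ∈ Ideal.span (Set.range (X : σ → MvPolynomial σ 𝕜)) :=
      (Submodule.Quotient.mk_eq_zero _).1 ha
    have h2 : Ideal.span (Set.range (X : σ → MvPolynomial σ 𝕜)) ≤ RingHom.ker constantCoeff := by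
      rw [Ideal.span_le]
      rintro _ ⟨x, rfl⟩
      simp
    simpa using h2 h1
  have hs : Function.Surjective f := by
    intro k
    obtain ⟨p, rfl⟩ := Submodule.Quotient.mk_surjective _ k
    refine ⟨constantCoeff p, ?_⟩
    have := (Submodule.Quotient.eq _).2 (hC p)
    exact this.symm
  have := (LinearEquiv.ofBijective f ⟨hi, hs⟩).rank_eq
  have h1 : Module.rank 𝕜 𝕜 = 1 := Module.rank_self 𝕜
  exact this.symm.trans h1

/-- monomial ideal -/
noncomputable def mI (S : Set (σ →₀ ℕ)) : Ideal (MvPolynomial σ 𝕜) :=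
  Ideal.span ((fun s => monomial s (1 : 𝕜)) '' S)

/-- `R/I` -/
noncomputable def Rq (I : Ideal (MvPolynomial σ 𝕜)) : ModuleCat.{0} (MvPolynomial σ 𝕜) :=
  ModuleCat.of _ (MvPolynomial σ 𝕜 ⧸ I)

/-- Betti numbers of `R/I` -/
noncomputable def rB (I : Ideal (MvPolynomial σ 𝕜)) (i : ℕ) : Cardinal :=
  rk 𝕜 ((tc (PK 𝕜 σ) (Rq 𝕜 I)).homology i)

/-- The Betti numbers of `R/I(S)` are the coefficients of `p`. -/
def HasB (S : Set (σ →₀ ℕ)) (p : Polynomial ℕ) : Prop :=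
  ∀ i, rB 𝕜 (mI 𝕜 S) i = (p.coeff i : Cardinal)

lemma mem_mI {S : Set (σ →₀ ℕ)} {p : MvPolynomial σ 𝕜} :
    p ∈ mI 𝕜 S ↔ ∀ a ∈ p.support, ∃ s ∈ S, s ≤ a := mem_ideal_span_monomial_image

lemma mI_mono {S T : Set (σ →₀ ℕ)} (h : ∀ s ∈ S, ∃ t ∈ T, t ≤ s) : mI 𝕜 S ≤ mI 𝕜 T := by
  intro p hp
  rw [mem_mI] at *
  intro a ha
  obtain ⟨s, hs, hsa⟩ := hp a ha
  obtain ⟨t, ht, hts⟩ := h s hs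
  exact ⟨t, ht, hts.trans hsa⟩

lemma mem_colon {S : Set (σ →₀ ℕ)} {p : MvPolynomial σ 𝕜} (f : σ →₀ ℕ) :
    monomial f 1 * p ∈ mI 𝕜 S ↔ p ∈ mI 𝕜 ((fun s => s - f) '' S) := by
  simp only [mem_mI]
  constructor
  · intro h a ha
    obtain ⟨s, hs, hsa⟩ := h (f + a) (by
      rw [mem_support_iff] at *
      rw [coeff_monomial_mul]
      simpa using ha)
    exact ⟨_, ⟨s, hs, rfl⟩, by rw [tsub_le_iff_left]; exact hsa⟩
  · intro h a ha
    rw [mem_support_iff, coeff_monomial_mul'] at ha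
    have hfa : f ≤ a := by
      by_contra hc
      simp [hc] at ha
    obtain ⟨_, ⟨s, hs, rfl⟩, hsa⟩ := h (a - f) (by
      rw [mem_support_iff]
      simpa [hfa] using ha)
    refine ⟨s, hs, ?_⟩
    have h2 := tsub_le_iff_left.1 hsa
    rwa [add_tsub_cancel_of_le hfa] at h2

lemma HasB.congr {S T : Set (σ →₀ ℕ)} {p : Polynomial ℕ} (h : HasB 𝕜 S p)
    (h1 : ∀ s ∈ S, ∃ t ∈ T, t ≤ s) (h2 : ∀ t ∈ T, ∃ s ∈ S, s ≤ t) : HasB 𝕜 T p := by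
  have : mI 𝕜 T = mI 𝕜 S := le_antisymm (mI_mono 𝕜 h2) (mI_mono 𝕜 h1)
  unfold HasB
  rw [this]
  exact h

lemma hasB_empty : HasB 𝕜 (∅ : Set (σ →₀ ℕ)) 1 := by
  have h0 : mI 𝕜 (∅ : Set (σ →₀ ℕ)) = ⊥ := by simp [mI]
  intro i
  rw [h0]
  let e : Rq 𝕜 (⊥ : Ideal (MvPolynomial σ 𝕜)) ≅ 𝟙_ (ModuleCat.{0} (MvPolynomial σ 𝕜)) :=
    LinearEquiv.toModuleIso (Submodule.quotEquivOfEqBot ⊥ rfl)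
  unfold rB
  have e' := HomologicalComplex.homologyMapIso (tcIso (PK 𝕜 σ) e) i
  rw [rk_iso 𝕜 e']
  cases i with
  | zero => simp [rk_iso 𝕜 (tcUnit0 (PK 𝕜 σ)), rk_Km]
  | succ i => simp [rk_isZero 𝕜 (tcUnit_succ (PK 𝕜 σ) i), Polynomial.coeff_one]

lemma hasB_insert {S : Set (σ →₀ ℕ)} {p q : Polynomial ℕ} (f : σ →₀ ℕ) (x : σ)
    (hx : 0 < f x) (hS : ∀ s ∈ S, s x < f x) (hp : HasB 𝕜 S p)
    (hq : HasB 𝕜 ((fun s => s - f) '' S) q) : HasB 𝕜 (insert f S) (p + Polynomial.X * q) := by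
  classical
  let f' : σ →₀ ℕ := f - Finsupp.single x 1
  have hf : f = Finsupp.single x 1 + f' := by
    refine (add_tsub_cancel_of_le ?_).symm
    rw [Finsupp.single_le_iff]
    exact hx
  have hc : ∀ s ∈ S, s - f = s - f' := by
    intro s hs
    ext y
    by_cases hy : y = x
    · subst hy
      have := hS s hs
      have h2 : f y = 1 + f' y := by
        conv_lhs => rw [hf]
        simp
      simp only [Finsupp.tsub_apply]
      omega
    · have h2 : f y = f' y := by
        conv_lhs => rw [hf]
        simp [Ne.symm hy]
      simp only [Finsupp.tsub_apply, h2]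
  have hc' : ((fun s => s - f) '' S) = ((fun s => s - f') '' S) := Set.image_congr hc
  let J := mI 𝕜 S
  let Cn := mI 𝕜 ((fun s => s - f) '' S)
  let L := mI 𝕜 (insert f S)
  have hJL : J ≤ L := mI_mono 𝕜 (fun s hs => ⟨s, Or.inr hs, le_rfl⟩)
  let φ : (MvPolynomial σ 𝕜 ⧸ Cn) →ₗ[MvPolynomial σ 𝕜] (MvPolynomial σ 𝕜 ⧸ J) :=
    Submodule.mapQ Cn J (LinearMap.mulLeft _ (monomial f 1))
      (fun r hr => (mem_colon 𝕜 f).2 hr)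
  let φ' : (MvPolynomial σ 𝕜 ⧸ Cn) →ₗ[MvPolynomial σ 𝕜] (MvPolynomial σ 𝕜 ⧸ J) :=
    Submodule.mapQ Cn J (LinearMap.mulLeft _ (monomial f' 1))
      (fun r hr => (mem_colon 𝕜 f').2 (hc' ▸ hr))
  let ψ : (MvPolynomial σ 𝕜 ⧸ J) →ₗ[MvPolynomial σ 𝕜] (MvPolynomial σ 𝕜 ⧸ L) :=
    Submodule.factor hJL
  have hfL : monomial f 1 ∈ L := Ideal.subset_span ⟨f, Or.inl rfl, rfl⟩
  have hL : ∀ r ∈ L, ∃ u, r - monomial f 1 * u ∈ J := by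
    intro r hr
    have : L = Ideal.span {monomial f 1} ⊔ J := by
      simp only [L, J, mI, Set.image_insert_eq, Ideal.span_insert]
    rw [this, Ideal.mem_span_singleton_sup] at hr
    obtain ⟨u, b, hb, rfl⟩ := hr
    refine ⟨u, ?_⟩
    rw [mul_comm, add_sub_cancel_left]
    exact hb
  have hexact : Function.Exact φ ψ := by
    intro b
    obtain ⟨r, rfl⟩ := Submodule.Quotient.mk_surjective _ b
    constructor
    · intro h
      have hr : r ∈ L := (Submodule.Quotient.mk_eq_zero _).1 h
      obtain ⟨u, hu⟩ := hL r hr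
      refine ⟨Submodule.Quotient.mk u, ?_⟩
      exact ((Submodule.Quotient.eq _).2 hu).symm
    · rintro ⟨c, hc⟩
      obtain ⟨u, rfl⟩ := Submodule.Quotient.mk_surjective _ c
      rw [← hc]
      exact (Submodule.Quotient.mk_eq_zero _).2 (Ideal.mul_mem_right _ _ hfL)
  have hinj : Function.Injective φ := by
    rw [injective_iff_map_eq_zero]
    intro c h
    obtain ⟨u, rfl⟩ := Submodule.Quotient.mk_surjective _ c
    exact (Submodule.Quotient.mk_eq_zero _).2 ((mem_colon 𝕜 f).1
      ((Submodule.Quotient.mk_eq_zero _).1 h))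
  have hsurj : Function.Surjective ψ := by
    intro c
    obtain ⟨u, rfl⟩ := Submodule.Quotient.mk_surjective _ c
    exact ⟨Submodule.Quotient.mk u, rfl⟩
  let T : ShortComplex (ModuleCat.{0} (MvPolynomial σ 𝕜)) :=
    ShortComplex.mk (X₁ := Rq 𝕜 Cn) (X₂ := Rq 𝕜 J) (X₃ := Rq 𝕜 L)
      (ModuleCat.ofHom φ) (ModuleCat.ofHom ψ) (by
        apply ModuleCat.hom_ext
        apply LinearMap.ext
        exact hexact.apply_apply_eq_zero)
  have hT : T.ShortExact := by
    refine ShortComplex.ShortExact.mk' ?_ ?_ ?_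
    · rw [ShortComplex.ShortExact.moduleCat_exact_iff_function_exact]
      exact hexact
    · rw [ModuleCat.mono_iff_injective]
      exact hinj
    · rw [ModuleCat.epi_iff_surjective]
      exact hsurj
  have hz : ∀ i, HomologicalComplex.homologyMap (tcMap (PK 𝕜 σ) T.f) i = 0 := by
    intro i
    refine tcMap_smul_homology (PK 𝕜 σ) T.f (ModuleCat.ofHom φ') (X x) (X_smul_Km 𝕜 x) ?_ i
    intro a
    obtain ⟨u, rfl⟩ := Submodule.Quotient.mk_surjective _ a
    change Submodule.Quotient.mk (monomial f 1 * u) =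
      Submodule.Quotient.mk (X x * (monomial f' 1 * u))
    congr 1
    rw [← mul_assoc, X, monomial_mul, ← hf, one_mul]
  intro i
  cases i with
  | zero =>
    have := rk_split_zero 𝕜 (PK 𝕜 σ) T hT (hz 0)
    refine this.trans ((hp 0).trans ?_)
    simp
  | succ i =>
    have := rk_split_succ 𝕜 (PK 𝕜 σ) T hT hz i
    refine this.trans ?_
    have e1 := hp (i+1)
    have e2 := hq i
    rw [Polynomial.coeff_add, Polynomial.coeff_X_mul, Nat.cast_add, ← e1, ← e2]
    rfl

/-- Passing from `R/I` to the ideal `I`. -/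
lemma betti_of_hasB {S : Set (σ →₀ ℕ)} {p : Polynomial ℕ} (h : HasB 𝕜 S p)
    (h0 : p.coeff 0 = 1) (i : ℕ) : betti 𝕜 (mI 𝕜 S) i = (p.coeff (i+1) : Cardinal) := by
  let I := mI 𝕜 S
  let T : ShortComplex (ModuleCat.{0} (MvPolynomial σ 𝕜)) :=
    ShortComplex.mk (X₁ := ModuleCat.of _ I) (X₂ := ModuleCat.of _ (MvPolynomial σ 𝕜))
      (X₃ := Rq 𝕜 I)
      (ModuleCat.ofHom (Submodule.subtype I)) (ModuleCat.ofHom (Submodule.mkQ I)) (by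
        apply ModuleCat.hom_ext
        apply LinearMap.ext
        intro a
        exact (Submodule.Quotient.mk_eq_zero _).2 a.2)
  have hT : T.ShortExact := by
    refine ShortComplex.ShortExact.mk' ?_ ?_ ?_
    · rw [ShortComplex.ShortExact.moduleCat_exact_iff_function_exact]
      exact LinearMap.exact_subtype_mkQ I
    · rw [ModuleCat.mono_iff_injective]
      exact Submodule.subtype_injective I
    · rw [ModuleCat.epi_iff_surjective]
      exact Submodule.mkQ_surjective I
  have h1 : betti 𝕜 I i = rk 𝕜 ((tc (PK 𝕜 σ) T.X₁).homology i) :=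
    (rk_eq 𝕜 _).trans (rk_iso 𝕜 (torIso (PK 𝕜 σ) (ModuleCat.of _ I) i))
  rw [h1, rk_shift 𝕜 (PK 𝕜 σ) T hT (Iso.refl _) (rk_Km 𝕜) ((h 0).trans (by simp [h0])) i]
  exact h (i+1)

end mono
end BettiAux
namespace BettiAux

section comb
variable (𝕜 : Type) [Field 𝕜] {σ : Type}

/-- Dominant families: the Taylor resolution is minimal. -/
lemma hasB_dom {ι : Type} [DecidableEq ι] (J : Finset ι) : ∀ (v : ι → σ →₀ ℕ),
    (∀ j ∈ J, ∃ x, 0 < v j x ∧ ∀ k ∈ J, k ≠ j → v k x < v j x) →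
    HasB 𝕜 (v '' (J : Set ι)) ((1 + Polynomial.X) ^ J.card) := by
  induction J using Finset.induction_on with
  | empty =>
    intro v _
    simpa using hasB_empty 𝕜
  | insert j J hj ih =>
    intro v hv
    obtain ⟨x, hx0, hx⟩ := hv j (Finset.mem_insert_self _ _)
    have hne : ∀ k ∈ J, k ≠ j := fun k hk h => hj (h ▸ hk)
    have h1 := ih v (fun k hk => by
      obtain ⟨y, hy0, hy⟩ := hv k (Finset.mem_insert_of_mem hk)
      exact ⟨y, hy0, fun l hl => hy l (Finset.mem_insert_of_mem hl)⟩)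
    have h2 := ih (fun k => v k - v j) (fun k hk => by
      obtain ⟨y, hy0, hy⟩ := hv k (Finset.mem_insert_of_mem hk)
      have hj := hy j (Finset.mem_insert_self _ _) (hne k hk).symm
      refine ⟨y, ?_, fun l hl hlk => ?_⟩
      · simp only [Finsupp.tsub_apply]
        omega
      · have := hy l (Finset.mem_insert_of_mem hl) hlk
        simp only [Finsupp.tsub_apply]
        omega)
    have h3 := hasB_insert 𝕜 (S := v '' (J : Set ι)) (v j) x hx0 (by
      rintro _ ⟨k, hk, rfl⟩
      exact hx k (Finset.mem_insert_of_mem hk) (hne k hk)) h1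
      (by rw [Set.image_image]; exact h2)
    rw [Finset.coe_insert, Set.image_insert_eq, Finset.card_insert_of_notMem hj]
    convert h3 using 1
    ring

variable {m : ℕ}

/-- exponent of `x_{i,1}^3 x_{i,2}` -/
noncomputable def Av (i : Fin m) : Fin m × Fin 2 →₀ ℕ :=
  Finsupp.single (i, (0 : Fin 2)) 3 + Finsupp.single (i, 1) 1

/-- exponent of `x_{i,1}^2 x_{i+1,1} x_{i+1,2}` -/
noncomputable def Bv (s : Fin m → Fin m) (i : Fin m) : Fin m × Fin 2 →₀ ℕ :=
  Finsupp.single (i, (0 : Fin 2)) 2 + Finsupp.single (s i, (0 : Fin 2)) 1 +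
    Finsupp.single (s i, (1 : Fin 2)) 1

/-- sum of the exponents over `T` -/
noncomputable def fT (T : Finset (Fin m)) : Fin m × Fin 2 →₀ ℕ := ∑ i ∈ T, Av i

lemma Av_zero (i j : Fin m) : Av i (j, 0) = if i = j then 3 else 0 := by
  simp [Av, Finsupp.single_apply]

lemma Av_one (i j : Fin m) : Av i (j, 1) = if i = j then 1 else 0 := by
  simp [Av, Finsupp.single_apply]

lemma Bv_zero (s : Fin m → Fin m) (i j : Fin m) :
    Bv s i (j, 0) = (if i = j then 2 else 0) + (if s i = j then 1 else 0) := by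
  simp [Bv, Finsupp.single_apply]

lemma Bv_one (s : Fin m → Fin m) (i j : Fin m) :
    Bv s i (j, 1) = if s i = j then 1 else 0 := by
  simp [Bv, Finsupp.single_apply]

lemma fT_zero (T : Finset (Fin m)) (j : Fin m) : fT T (j, 0) = if j ∈ T then 3 else 0 := by
  simp [fT, Finsupp.finsetSum_apply, Av_zero]

lemma fT_one (T : Finset (Fin m)) (j : Fin m) : fT T (j, 1) = if j ∈ T then 1 else 0 := by
  simp [fT, Finsupp.finsetSum_apply, Av_one]

/-- the generators -/
def Egen (s : Fin m → Fin m) (T : Finset (Fin m)) (U : Set (Fin m)) :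
    Set (Fin m × Fin 2 →₀ ℕ) :=
  Set.range (fun j => Bv s j - fT T) ∪ Av '' U

lemma fv_le {f g : Fin m × Fin 2 →₀ ℕ} (h0 : ∀ j, f (j, 0) ≤ g (j, 0))
    (h1 : ∀ j, f (j, 1) ≤ g (j, 1)) : f ≤ g := by
  rintro ⟨j, c⟩
  fin_cases c
  · exact h0 j
  · exact h1 j

lemma hasB_step (s : Fin m → Fin m) (hs : ∀ i, s i ≠ i) (T : Finset (Fin m)) (i : Fin m)
    (hi : i ∉ T) (U V : Set (Fin m)) (hiU : i ∉ U) (hVU : V ⊆ U)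
    (hUV : ∀ j ∈ U, j ∈ V ∨ j = s i ∨ i = s j) {p q : Polynomial ℕ}
    (hp : HasB 𝕜 (Egen s T U) p) (hq : HasB 𝕜 (Egen s (insert i T) V) q) :
    HasB 𝕜 (Egen s T (insert i U)) (p + Polynomial.X * q) := by
  have hE : Egen s T (insert i U) = insert (Av i) (Egen s T U) := by
    simp [Egen, Set.image_insert_eq, Set.union_insert]
  have hf : fT (insert i T) = fT T + Av i := by
    rw [fT, Finset.sum_insert hi, add_comm, fT]
  have hB : ∀ j, Bv s j - fT (insert i T) = Bv s j - fT T - Av i := by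
    intro j
    rw [hf, tsub_tsub]
  rw [hE]
  refine hasB_insert 𝕜 (Av i) (i, 0) ?_ ?_ hp ?_
  · simp [Av_zero]
  · rintro _ (⟨j, rfl⟩ | ⟨j, hj, rfl⟩)
    · have := hs j
      simp only [Finsupp.tsub_apply, Bv_zero, Av_zero, if_true]
      split_ifs <;> first | omega | (exfalso; simp_all)
    · have : j ≠ i := fun h => hiU (h ▸ hj)
      simp [Av_zero, this]
  · refine hq.congr 𝕜 ?_ ?_
    · rintro _ (⟨j, rfl⟩ | ⟨j, hj, rfl⟩)
      · exact ⟨_, ⟨_, Or.inl ⟨j, rfl⟩, rfl⟩, (hB j).ge⟩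
      · exact ⟨_, ⟨_, Or.inr ⟨j, hVU hj, rfl⟩, rfl⟩, tsub_le_self⟩
    · rintro _ ⟨_, (⟨j, rfl⟩ | ⟨j, hj, rfl⟩), rfl⟩
      · exact ⟨_, Or.inl ⟨j, rfl⟩, (hB j).le⟩
      · have hji : i ≠ j := fun h => hiU (h ▸ hj)
        have hA : Av j - Av i = Av j := by
          ext ⟨k, c⟩
          fin_cases c
          · simp only [Finsupp.tsub_apply]
            simp [Av_zero]
            grind
          · simp only [Finsupp.tsub_apply]
            simp [Av_one]
            grind
        simp only [hA]
        rcases hUV j hj with h | h | h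
        · exact ⟨_, Or.inr ⟨j, h, rfl⟩, le_rfl⟩
        · refine ⟨_, Or.inl ⟨i, rfl⟩, fv_le ?_ ?_⟩
          · intro k
            simp only [Finsupp.tsub_apply, Bv_zero, Av_zero, fT_zero, Finset.mem_insert]
            grind
          · intro k
            simp only [Finsupp.tsub_apply, Bv_one, Av_one, fT_one, Finset.mem_insert]
            grind
        · refine ⟨_, Or.inl ⟨j, rfl⟩, fv_le ?_ ?_⟩
          · intro k
            simp only [Finsupp.tsub_apply, Bv_zero, Av_zero, fT_zero, Finset.mem_insert]
            grind
          · intro k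
            simp only [Finsupp.tsub_apply, Bv_one, Av_one, fT_one, Finset.mem_insert]
            grind

lemma hasB_base (s : Fin m → Fin m) (hs : ∀ i, s i ≠ i) (hinj : Function.Injective s)
    (T : Finset (Fin m)) (hT : ∀ j ∈ T, s j ∉ T) :
    HasB 𝕜 (Egen s T ∅) ((1 + Polynomial.X) ^ m) := by
  have h := hasB_dom 𝕜 (Finset.univ : Finset (Fin m)) (fun j => Bv s j - fT T) (by
    intro j _
    by_cases hj : s j ∈ T
    · have hj' : j ∉ T := fun h => hT j h hj
      refine ⟨(j, 0), ?_, ?_⟩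
      · simp only [Finsupp.tsub_apply, Bv_zero, fT_zero]
        grind
      · intro k _ hk
        simp only [Finsupp.tsub_apply, Bv_zero, fT_zero]
        grind
    · refine ⟨(s j, 1), ?_, ?_⟩
      · simp only [Finsupp.tsub_apply, Bv_one, fT_one]
        grind
      · intro k _ hk
        have : s k ≠ s j := fun h => hk (hinj h)
        simp only [Finsupp.tsub_apply, Bv_one, fT_one]
        grind)
  simpa [Egen] using h

/-- independence polynomials of paths -/
noncomputable def Fp : ℕ → Polynomial ℕ
  | 0 => 1
  | 1 => 1 + Polynomial.X
  | n + 2 => Fp (n + 1) + Polynomial.X * Fp n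

/-- interval -/
def Iv (a l : ℕ) : Set (Fin m) := {j | a ≤ j.val ∧ j.val < a + l}

lemma hasB_path (s : Fin m → Fin m) (hs : ∀ i, s i ≠ i) (hinj : Function.Injective s)
    (hs1 : ∀ i : Fin m, i.val + 1 < m → (s i).val = i.val + 1) (l : ℕ) :
    ∀ (a : ℕ) (T : Finset (Fin m)), a + l < m → (∀ j ∈ T, s j ∉ T) →
      (∀ j ∈ T, ∀ u ∈ Iv a l, j ≠ u ∧ s j ≠ u ∧ s u ≠ j) →
      HasB 𝕜 (Egen s T (Iv a l)) ((1 + Polynomial.X) ^ m * Fp l) := by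
  have key : ∀ (l l' a : ℕ) (T : Finset (Fin m)), a + (l + 1) < m → l' = l - 1 →
      (∀ j ∈ T, s j ∉ T) →
      (∀ j ∈ T, ∀ u ∈ Iv a (l + 1), j ≠ u ∧ s j ≠ u ∧ s u ≠ j) →
      ∀ p q, (∀ T, (∀ j ∈ T, s j ∉ T) →
      (∀ j ∈ T, ∀ u ∈ Iv a l, j ≠ u ∧ s j ≠ u ∧ s u ≠ j) → HasB 𝕜 (Egen s T (Iv a l)) p) →
      (∀ T, (∀ j ∈ T, s j ∉ T) →
      (∀ j ∈ T, ∀ u ∈ Iv a l', j ≠ u ∧ s j ≠ u ∧ s u ≠ j) → HasB 𝕜 (Egen s T (Iv a l')) q) →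
      HasB 𝕜 (Egen s T (Iv a (l + 1))) (p + Polynomial.X * q) := by
    intro l l' a T hal hl' hT hTU p q hp hq
    let i : Fin m := ⟨a + l, by omega⟩
    have hiI : i ∈ Iv a (l + 1) := ⟨by simp [i], by simp [i]⟩
    have hU : (Iv a (l + 1) : Set (Fin m)) = insert i (Iv a l) := by
      ext j
      simp only [Iv, Set.mem_ofPred_eq, Set.mem_insert_iff, Fin.ext_iff, i]
      omega
    have hsub : (Iv a l' : Set (Fin m)) ⊆ Iv a l := by
      intro j hj
      simp only [Iv, Set.mem_ofPred_eq] at *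
      omega
    have hsub2 : (Iv a l : Set (Fin m)) ⊆ Iv a (l + 1) := by
      rw [hU]
      exact Set.subset_insert _ _
    have hiT : i ∉ T := fun h => (hTU i h i hiI).1 rfl
    have hsi : (s i).val = a + l + 1 := hs1 i (by simp [i]; omega)
    rw [hU]
    refine hasB_step 𝕜 s hs T i hiT _ (Iv a l') (by simp [Iv, i]) hsub ?_
      (hp T hT (fun j hj u hu => hTU j hj u (hsub2 hu))) (hq _ ?_ ?_)
    · intro j hj
      by_cases h : j ∈ Iv a l'
      · exact Or.inl h
      · right
        right
        simp only [Iv, Set.mem_ofPred_eq] at h hj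
        apply Fin.ext
        rw [hs1 j (by omega)]
        simp only [i]
        omega
    · intro j hj
      rw [Finset.mem_insert] at hj ⊢
      rintro (h | h)
      · rcases hj with rfl | hj
        · exact hs _ h
        · exact (hTU j hj i hiI).2.1 h
      · rcases hj with rfl | hj
        · exact (hTU _ h _ hiI).2.2 rfl
        · exact hT j hj h
    · intro j hj u hu
      rw [Finset.mem_insert] at hj
      rcases hj with rfl | hj
      · simp only [Iv, Set.mem_ofPred_eq] at hu
        have h3 := hs1 u (by omega)
        refine ⟨?_, ?_, ?_⟩
        · intro h
          have := congrArg Fin.val h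
          simp only [i] at this
          omega
        · intro h
          have := congrArg Fin.val h
          omega
        · intro h
          have := congrArg Fin.val h
          simp only [i] at this
          omega
      · exact hTU j hj u (hsub2 (hsub hu))
  have hz : ∀ a, (Iv a 0 : Set (Fin m)) = ∅ := by
    intro a
    ext j
    simp [Iv]
  have base : ∀ (a : ℕ) (T : Finset (Fin m)), (∀ j ∈ T, s j ∉ T) →
      HasB 𝕜 (Egen s T (Iv a 0)) ((1 + Polynomial.X) ^ m) := by
    intro a T hT
    rw [hz]
    exact hasB_base 𝕜 s hs hinj T hT
  induction l using Nat.twoStepInduction with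
  | zero =>
    intro a T _ hT _
    simpa [Fp] using base a T hT
  | one =>
    intro a T ha hT hTU
    have := key 0 0 a T ha rfl hT hTU _ _ (fun T hT _ => base a T hT) (fun T hT _ => base a T hT)
    convert this using 1
    simp only [Fp]
    ring
  | more l ih1 ih2 =>
    intro a T ha hT hTU
    have := key (l + 1) l a T ha rfl hT hTU _ _ (fun T hT h => ih2 a T (by omega) hT h)
      (fun T hT h => ih1 a T (by omega) hT h)
    convert this using 1
    simp only [Fp]
    ring

lemma hasB_cycle (n : ℕ) (hm : m = n + 3) (s : Fin m → Fin m) (hs : ∀ i, s i ≠ i)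
    (hinj : Function.Injective s)
    (hs1 : ∀ i : Fin m, i.val + 1 < m → (s i).val = i.val + 1)
    (hs2 : ∀ i : Fin m, i.val + 1 = m → (s i).val = 0) :
    HasB 𝕜 (Egen s ∅ Set.univ)
      ((1 + Polynomial.X) ^ m * (Fp (n + 2) + Polynomial.X * Fp n)) := by
  let i : Fin m := ⟨n + 2, by omega⟩
  have hU : (Set.univ : Set (Fin m)) = insert i (Iv 0 (n + 2)) := by
    ext j
    simp only [Iv, Set.mem_ofPred_eq, Set.mem_insert_iff, Fin.ext_iff, i, Set.mem_univ, true_iff]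
    have hlt := j.isLt
    omega
  have hsi : (s i).val = 0 := hs2 i (by simp [i]; omega)
  rw [hU]
  have := hasB_step 𝕜 s hs ∅ i (by simp) (Iv 0 (n + 2)) (Iv 1 n) (by simp [Iv, i]) ?_ ?_
    (hasB_path 𝕜 s hs hinj hs1 (n + 2) 0 ∅ (by omega) (by simp) (by simp))
    (hasB_path 𝕜 s hs hinj hs1 n 1 (insert i ∅) (by omega) ?_ ?_)
  · convert this using 1
    ring
  · intro j hj
    simp only [Iv, Set.mem_ofPred_eq] at hj ⊢
    refine ⟨Nat.zero_le _, ?_⟩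
    have h2 := hj.2
    omega
  · intro j hj
    simp only [Iv, Set.mem_ofPred_eq] at hj ⊢
    by_cases h1 : 1 ≤ j.val ∧ j.val < 1 + n
    · exact Or.inl h1
    · right
      by_cases h2 : j.val = 0
      · left
        apply Fin.ext
        omega
      · right
        apply Fin.ext
        rw [hs1 j (by omega)]
        simp only [i]
        omega
  · intro j hj
    simp at hj
    subst hj
    simp [hs]
  · intro j hj u hu
    simp at hj
    subst hj
    simp only [Iv, Set.mem_ofPred_eq] at hu
    have h3 := hs1 u (by omega)
    refine ⟨?_, ?_, ?_⟩
    · intro h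
      have := congrArg Fin.val h
      simp only [i] at this
      omega
    · intro h
      have := congrArg Fin.val h
      omega
    · intro h
      have := congrArg Fin.val h
      simp only [i] at this
      omega

end comb

lemma Fp_coeff_zero (m a : ℕ) : ((1 + Polynomial.X) ^ m * Fp a).coeff 0 = 1 := by
  induction a using Nat.twoStepInduction with
  | zero => simp [Fp, Polynomial.coeff_zero_eq_eval_zero]
  | one => simp [Fp, Polynomial.coeff_zero_eq_eval_zero]
  | more a ih1 ih2 =>
    have : ((1 + Polynomial.X) ^ m * Fp (a + 2)) =
      (1 + Polynomial.X) ^ m * Fp (a + 1) + Polynomial.X * ((1 + Polynomial.X) ^ m * Fp a) := by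
      simp only [Fp]
      ring
    rw [this, Polynomial.coeff_add, Polynomial.coeff_X_mul_zero, ih2, add_zero]

lemma Fp_coeff_succ (m a b : ℕ) : ((1 + Polynomial.X) ^ m * Fp a).coeff (b + 1) = Kno m a b := by
  induction a using Nat.twoStepInduction generalizing b with
  | zero =>
    cases b with
    | zero => simp [Fp, Kno, Polynomial.coeff_one_add_X_pow]
    | succ b => simp [Fp, Kno, Polynomial.coeff_one_add_X_pow]
  | one =>
    have : ((1 + Polynomial.X) ^ m * Fp 1) = (1 + Polynomial.X) ^ (m + 1) := by
      simp only [Fp]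
      ring
    rw [this, Polynomial.coeff_one_add_X_pow]
    cases b with
    | zero => simp [Kno]
    | succ b => simp [Kno, Nat.choose_succ_succ]
  | more a ih1 ih2 =>
    have : ((1 + Polynomial.X) ^ m * Fp (a + 2)) =
      (1 + Polynomial.X) ^ m * Fp (a + 1) + Polynomial.X * ((1 + Polynomial.X) ^ m * Fp a) := by
      simp only [Fp]
      ring
    rw [this, Polynomial.coeff_add, Polynomial.coeff_X_mul, ih2]
    cases b with
    | zero =>
      rw [Fp_coeff_zero]
      simp [Kno]
      ring
    | succ b =>
      rw [ih1]
      simp [Kno]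
      ring

end BettiAux

/-- Proposition 3.5: Betti numbers of `I_m`. Variables `x_{i,1}, x_{i,2}` are indexed by
`(i-1, 0), (i-1, 1) : Fin m × Fin 2`, the first index being cyclic mod `m`.
`β_0(I_m) = 2m` and `β_i(I_m) = 2·K^m_{m−3,i−1} + K^m_{m−2,i}` for `i ≥ 1`. -/
theorem stmt6 {𝕜 : Type} [Field 𝕜] (m : ℕ) (hm : 3 ≤ m)
    (I : Ideal (MvPolynomial (Fin m × Fin 2) 𝕜))
    (hI : I = Ideal.span { f |
      (∃ i : Fin m,
        f = monomial (Finsupp.single (i, (0 : Fin 2)) 3 + Finsupp.single (i, 1) 1) (1 : 𝕜)) ∨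
      (∃ i : Fin m,
        f = monomial (Finsupp.single (i, (0 : Fin 2)) 2 +
          Finsupp.single (i + ⟨1, by omega⟩, (0 : Fin 2)) 1 +
          Finsupp.single (i + ⟨1, by omega⟩, (1 : Fin 2)) 1) (1 : 𝕜)) }) :
    betti 𝕜 I 0 = ((2 * m : ℕ) : Cardinal) ∧
    ∀ i : ℕ, 1 ≤ i →
      betti 𝕜 I i = ((2 * Kno m (m - 3) (i - 1) + Kno m (m - 2) i : ℕ) : Cardinal) := by
  obtain ⟨n, hn⟩ : ∃ n, m = n + 3 := ⟨m - 3, by omega⟩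
  let s : Fin m → Fin m := fun i => i + ⟨1, by omega⟩
  have hval : ∀ i : Fin m, (s i).val = (i.val + 1) % m := fun i => Fin.val_add _ _
  have hs1 : ∀ i : Fin m, i.val + 1 < m → (s i).val = i.val + 1 := by
    intro i hi
    rw [hval, Nat.mod_eq_of_lt hi]
  have hs2 : ∀ i : Fin m, i.val + 1 = m → (s i).val = 0 := by
    intro i hi
    rw [hval, hi, Nat.mod_self]
  have hs : ∀ i, s i ≠ i := by
    intro i h
    have h' := congrArg Fin.val h
    have := i.isLt
    rcases Nat.lt_or_ge (i.val + 1) m with h1 | h1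
    · have := hs1 i h1
      omega
    · have := hs2 i (by omega)
      omega
  have hinj : Function.Injective s := by
    intro i j h
    have h' := congrArg Fin.val h
    have := i.isLt
    have := j.isLt
    apply Fin.ext
    rcases Nat.lt_or_ge (i.val + 1) m with h1 | h1 <;>
      rcases Nat.lt_or_ge (j.val + 1) m with h2 | h2
    · have := hs1 i h1
      have := hs1 j h2
      omega
    · have := hs1 i h1
      have := hs2 j (by omega)
      omega
    · have := hs2 i (by omega)
      have := hs1 j h2
      omega
    · omega
  have hB := BettiAux.hasB_cycle 𝕜 n hn s hs hinj hs1 hs2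
  have hI' : I = BettiAux.mI 𝕜 (BettiAux.Egen s ∅ Set.univ) := by
    rw [hI, BettiAux.mI]
    congr 1
    ext f
    simp only [BettiAux.Egen, BettiAux.fT, Finset.sum_empty, tsub_zero, Set.image_univ,
      Set.mem_ofPred_eq, Set.mem_image, Set.mem_union, Set.mem_range]
    constructor
    · rintro (⟨i, rfl⟩ | ⟨i, rfl⟩)
      · exact ⟨_, Or.inr ⟨i, rfl⟩, rfl⟩
      · exact ⟨_, Or.inl ⟨i, rfl⟩, rfl⟩
    · rintro ⟨_, (⟨i, rfl⟩ | ⟨i, rfl⟩), rfl⟩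
      · exact Or.inr ⟨i, rfl⟩
      · exact Or.inl ⟨i, rfl⟩
  have hpoly : ((1 + Polynomial.X) ^ m * (BettiAux.Fp (n + 2) + Polynomial.X * BettiAux.Fp n)) =
      (1 + Polynomial.X) ^ m * BettiAux.Fp (n + 2) +
        Polynomial.X * ((1 + Polynomial.X) ^ m * BettiAux.Fp n) := by
    ring
  rw [hpoly] at hB
  have hb := BettiAux.betti_of_hasB 𝕜 hB (by
    rw [Polynomial.coeff_add, Polynomial.coeff_X_mul_zero, BettiAux.Fp_coeff_zero, add_zero])
  rw [hI']
  constructor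
  · rw [hb 0, Polynomial.coeff_add, Polynomial.coeff_X_mul, BettiAux.Fp_coeff_zero,
      BettiAux.Fp_coeff_succ]
    congr 1
    simp [Kno]
    omega
  · intro i hi
    obtain ⟨i, rfl⟩ : ∃ j, i = j + 1 := ⟨i - 1, by omega⟩
    rw [hb (i + 1), Polynomial.coeff_add, Polynomial.coeff_X_mul, BettiAux.Fp_coeff_succ,
      BettiAux.Fp_coeff_succ]
    congr 1
    have e1 : m - 3 = n := by omega
    have e2 : m - 2 = n + 1 := by omega
    rw [e1, e2, Nat.add_sub_cancel]
    simp only [Kno]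
    ring
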